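/- For every prime q, if I : ℕ → {0,1} is the indicator function of the event n ∈ M^c(q), then 1 - d(q) = ∏_{p prime} [(1 - 1/p) · Σ_{m=0}^{∞} I(p^m)/p^m], where the product is over all primes p and d(q) is the natural density of M(q). -/

import Mathlib

open Filter Topology

/-- `TowerMem q n` means that the prime `q` occurs somewhere in the tower
factorization of the positive integer `n`:  `1 ∉ M(q)`, and for `n ≥ 2`,
`n ∈ M(q)` iff `q ∣ n` or some exponent in the prime factorization of `n`
lies in `M(q)`. -/
inductive TowerMem (q : ℕ) : ℕ → Prop
  | base (n : ℕ) (hn : 2 ≤ n) (hdvd : q ∣ n) : TowerMem q n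
  | step (n p : ℕ) (hn : 2 ≤ n) (hp : p.Prime) (hdvd : p ∣ n)
      (hexp : TowerMem q (n.factorization p)) : TowerMem q n

open Classical in
/-- The proportion of the integers `{1, …, N}` that lie in `M(q)`. -/
noncomputable def towerRatio (q N : ℕ) : ℝ :=
  (((Finset.Icc 1 N).filter fun n => TowerMem q n).card : ℝ) / (N : ℝ)

section EulerFactor

variable {a : ℕ → ℝ} {x : ℝ}

lemma summable_mul_pow_of_mem_Icc (h0 : ∀ m, 0 ≤ a m) (h1 : ∀ m, a m ≤ 1)
    (hx0 : 0 ≤ x) (hx1 : x < 1) : Summable fun m ↦ a m * x ^ m :=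
  (summable_geometric_of_lt_one hx0 hx1).of_nonneg_of_le
    (fun m ↦ mul_nonneg (h0 m) (pow_nonneg hx0 m))
    fun m ↦ mul_le_of_le_one_left (pow_nonneg hx0 m) (h1 m)

lemma one_sub_mul_tsum_mul_pow_mem_Icc (h0 : ∀ m, 0 ≤ a m) (h1 : ∀ m, a m ≤ 1)
    (hx0 : 0 ≤ x) (hx1 : x < 1) {k : ℕ} (hk : ∀ m < k, a m = 1) :
    (1 - x) * ∑' m, a m * x ^ m ∈ Set.Icc (1 - x ^ k) 1 := by
  have hx : 0 < 1 - x := by linarith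
  have hgeo := summable_geometric_of_lt_one hx0 hx1
  have hsum := summable_mul_pow_of_mem_Icc h0 h1 hx0 hx1
  constructor
  · have htail : Summable fun m ↦ a (m + k) * x ^ (m + k) :=
      (summable_nat_add_iff (f := fun m ↦ a m * x ^ m) k).2 hsum
    have hsplit := hsum.sum_add_tsum_nat_add k
    have hhead : ∑ m ∈ Finset.range k, a m * x ^ m = ∑ m ∈ Finset.range k, x ^ m :=
      Finset.sum_congr rfl fun m hm ↦ by rw [hk m (Finset.mem_range.1 hm), one_mul]
    have hnonneg : 0 ≤ ∑' m, a (m + k) * x ^ (m + k) :=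
      tsum_nonneg fun m ↦ mul_nonneg (h0 _) (pow_nonneg hx0 _)
    rw [← hsplit, hhead, mul_add, mul_neg_geom_sum]
    linarith [mul_nonneg hx.le hnonneg]
  · have hle : ∑' m, a m * x ^ m ≤ (1 - x)⁻¹ := by
      rw [← tsum_geometric_of_lt_one hx0 hx1]
      exact hsum.tsum_le_tsum
        (fun m ↦ mul_le_of_le_one_left (pow_nonneg hx0 m) (h1 m)) hgeo
    calc (1 - x) * ∑' m, a m * x ^ m ≤ (1 - x) * (1 - x)⁻¹ := by gcongr
      _ = 1 := mul_inv_cancel₀ hx.ne'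

lemma continuousOn_tsum_mul_pow (h0 : ∀ m, 0 ≤ a m) (h1 : ∀ m, a m ≤ 1)
    {r : ℝ} (hr0 : 0 ≤ r) (hr1 : r < 1) :
    ContinuousOn (fun x : ℝ ↦ ∑' m, a m * x ^ m) (Set.Icc 0 r) := by
  refine continuousOn_tsum (fun m ↦ by fun_prop) (summable_geometric_of_lt_one hr0 hr1) ?_
  rintro m x ⟨hx0, hxr⟩
  rw [Real.norm_of_nonneg (mul_nonneg (h0 m) (pow_nonneg hx0 m))]
  exact (mul_le_of_le_one_left (pow_nonneg hx0 m) (h1 m)).trans (pow_le_pow_left₀ hx0 hxr m)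

end EulerFactor

section MeanValue

variable {g : ℕ → ℝ}

lemma summable_div_rpow_of_le_one (h0 : ∀ n, 0 ≤ g n) (hle : ∀ n, g n ≤ 1) {s : ℝ}
    (hs : 1 < s) : Summable fun n : ℕ ↦ g n / (n : ℝ) ^ s := by
  refine (Real.summable_one_div_nat_rpow.2 hs).of_nonneg_of_le
    (fun n ↦ div_nonneg (h0 n) (by positivity)) fun n ↦ ?_
  gcongr
  exact hle n

lemma tendsto_sub_mul_tsum_div_rpow (h0 : ∀ n, 0 ≤ g n) {l : ℝ}
    (hl : Tendsto (fun n : ℕ ↦ (∑ k ∈ Finset.Icc 1 n, g k) / (n : ℝ)) atTop (𝓝 l)) :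
    Tendsto (fun s : ℝ ↦ (s - 1) * ∑' n : ℕ, g n / (n : ℝ) ^ s) (𝓝[>] 1) (𝓝 l) := by
  rw [← Filter.tendsto_ofReal_iff]
  refine (LSeries_tendsto_sub_mul_nhds_one_of_tendsto_sum_div_and_nonneg g hl h0).congr' ?_
  filter_upwards [self_mem_nhdsWithin] with s hs
  have hs0 : s ≠ 0 := (zero_lt_one.trans hs).ne'
  push_cast
  congr 1
  refine tsum_congr fun n ↦ ?_
  rw [Complex.ofReal_cpow (Nat.cast_nonneg n), Complex.ofReal_natCast]
  rcases eq_or_ne n 0 with rfl | hn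
  · simp [hs0]
  · rw [LSeries.term_of_ne_zero hn]

lemma rpow_neg_mem_Icc {p : ℕ} (hp : p.Prime) {s : ℝ} (hs : 1 ≤ s) :
    ((p : ℝ) ^ s)⁻¹ ∈ Set.Icc 0 (p : ℝ)⁻¹ := by
  have hp1 : (1 : ℝ) ≤ p := by exact_mod_cast hp.one_le
  refine ⟨by positivity, inv_anti₀ (by positivity) ?_⟩
  simpa using Real.rpow_le_rpow_of_exponent_le hp1 hs

lemma inv_prime_le_half {p : ℕ} (hp : p.Prime) : (p : ℝ)⁻¹ ≤ 1 / 2 := by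
  rw [one_div]
  exact inv_anti₀ two_pos (by exact_mod_cast hp.two_le)

lemma tendsto_inv_rpow_nhdsGT_one {p : ℕ} (hp : p.Prime) :
    Tendsto (fun s : ℝ ↦ ((p : ℝ) ^ s)⁻¹) (𝓝[>] 1) (𝓝[Set.Icc 0 (1 / 2)] (p : ℝ)⁻¹) := by
  have hp0 : (0 : ℝ) < p := by exact_mod_cast hp.pos
  refine tendsto_nhdsWithin_iff.2 ⟨?_, ?_⟩
  · have hc : ContinuousAt (fun s : ℝ ↦ ((p : ℝ) ^ s)⁻¹) 1 :=
      (Real.continuousAt_const_rpow hp0.ne').inv₀ (Real.rpow_pos_of_pos hp0 1).ne'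
    simpa using hc.tendsto.mono_left nhdsWithin_le_nhds
  · filter_upwards [self_mem_nhdsWithin] with s hs
    have h := rpow_neg_mem_Icc hp (le_of_lt hs)
    exact ⟨h.1, h.2.trans (inv_prime_le_half hp)⟩

/-- The Euler factor at `p` of the quotient of the Dirichlet series of `g` by the Riemann zeta
function, as a function of `x = p ^ (-s)`. -/
noncomputable def quotientEulerFactor (g : ℕ → ℝ) (p : ℕ) (x : ℝ) : ℝ :=
  (1 - x) * ∑' m : ℕ, g (p ^ m) * x ^ m

lemma abs_quotientEulerFactor_sub_one_le (h1 : g 1 = 1) (h0 : ∀ n, 0 ≤ g n)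
    (hle : ∀ n, g n ≤ 1) {q : ℕ} (hq : 0 < q) (hg : ∀ p : ℕ, p.Prime → p ≠ q → g p = 1)
    {p : ℕ} (hp : p.Prime) {x : ℝ} (hx0 : 0 ≤ x) (hxp : x ≤ (p : ℝ)⁻¹) :
    |quotientEulerFactor g p x - 1| ≤ (q : ℝ) ^ 2 * ((p : ℝ) ^ 2)⁻¹ := by
  have hp0 : (0 : ℝ) < p := by exact_mod_cast hp.pos
  have hx1 : x < 1 := by linarith [inv_prime_le_half hp]
  have hmem := fun k ↦ one_sub_mul_tsum_mul_pow_mem_Icc (a := fun m ↦ g (p ^ m)) (x := x)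
    (fun m ↦ h0 _) (fun m ↦ hle _) hx0 hx1 (k := k)
  have habs : ∀ k, (∀ m < k, g (p ^ m) = 1) → |quotientEulerFactor g p x - 1| ≤ x ^ k := by
    intro k hk
    obtain ⟨hlo, hhi⟩ := hmem k hk
    unfold quotientEulerFactor
    rw [abs_le]
    constructor <;> linarith [pow_nonneg hx0 k]
  rcases eq_or_ne p q with rfl | hpq
  · rw [mul_inv_cancel₀ (by positivity)]
    simpa using habs 0 (by simp)
  · have hq1 : (1 : ℝ) ≤ (q : ℝ) ^ 2 := one_le_pow₀ (by exact_mod_cast hq)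
    calc |quotientEulerFactor g p x - 1| ≤ x ^ 2 := by
          refine habs 2 fun m hm ↦ ?_
          interval_cases m
          · simpa using h1
          · simpa using hg p hp hpq
      _ ≤ ((p : ℝ)⁻¹) ^ 2 := by gcongr
      _ = ((p : ℝ) ^ 2)⁻¹ := inv_pow _ _
      _ ≤ (q : ℝ) ^ 2 * ((p : ℝ) ^ 2)⁻¹ := le_mul_of_one_le_left (by positivity) hq1

lemma summable_const_mul_inv_prime_sq (c : ℝ) :
    Summable fun p : {p : ℕ // p.Prime} ↦ c * (((p : ℕ) : ℝ) ^ 2)⁻¹ :=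
  ((Real.summable_nat_pow_inv.2 one_lt_two).subtype {p | p.Prime}).mul_left c

lemma tprod_quotientEulerFactor_mul_tsum (h1 : g 1 = 1)
    (hmul : ∀ {m n : ℕ}, m.Coprime n → g (m * n) = g m * g n)
    (h0 : ∀ n, 0 ≤ g n) (hle : ∀ n, g n ≤ 1) {q : ℕ} (hq : 0 < q)
    (hg : ∀ p : ℕ, p.Prime → p ≠ q → g p = 1) {s : ℝ} (hs : 1 < s) :
    (∏' p : {p : ℕ // p.Prime}, quotientEulerFactor g p (((p : ℕ) : ℝ) ^ s)⁻¹) *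
      ∑' n : ℕ, 1 / (n : ℝ) ^ s = ∑' n : ℕ, g n / (n : ℝ) ^ s := by
  have hs0 : s ≠ 0 := (zero_lt_one.trans hs).ne'
  have euler : ∀ f : ℕ → ℝ, f 1 = 1 → (∀ {m n : ℕ}, m.Coprime n → f (m * n) = f m * f n) →
      (∀ n, 0 ≤ f n) → (∀ n, f n ≤ 1) →
      HasProd (fun p : {p : ℕ // p.Prime} ↦ ∑' m, f (p ^ m) * ((((p : ℕ) : ℝ) ^ s)⁻¹) ^ m)
        (∑' n : ℕ, f n / (n : ℝ) ^ s) := by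
    intro f hf1 hfmul hf0 hfle
    have key := EulerProduct.eulerProduct_hasProd (f := fun n : ℕ ↦ f n / (n : ℝ) ^ s)
      (by simp [hf1])
      (fun {m n} hmn ↦ by
        simp only [hfmul hmn, Nat.cast_mul,
          Real.mul_rpow (Nat.cast_nonneg m) (Nat.cast_nonneg n), mul_div_mul_comm])
      (summable_div_rpow_of_le_one hf0 hfle hs).norm (by simp [hs0])
    refine key.congr_fun fun p ↦ tsum_congr fun m ↦ ?_
    rw [Nat.cast_pow, ← Real.rpow_pow_comm (Nat.cast_nonneg _), inv_pow, div_eq_mul_inv]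
  have hzeta := euler (fun _ ↦ 1) rfl (by simp) (by simp) (by simp)
  have hgser := euler g h1 hmul h0 hle
  have hmultip : Multipliable fun p : {p : ℕ // p.Prime} ↦
      quotientEulerFactor g p (((p : ℕ) : ℝ) ^ s)⁻¹ := by
    have hsum : Summable fun p : {p : ℕ // p.Prime} ↦
        quotientEulerFactor g p (((p : ℕ) : ℝ) ^ s)⁻¹ - 1 :=
      (summable_const_mul_inv_prime_sq ((q : ℝ) ^ 2)).of_norm_bounded fun p ↦
        have hx := rpow_neg_mem_Icc p.2 hs.le
        abs_quotientEulerFactor_sub_one_le h1 h0 hle hq hg p.2 hx.1 hx.2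
    simpa using Real.multipliable_one_add_of_summable hsum
  refine (hmultip.hasProd.mul hzeta).unique (hgser.congr_fun fun p ↦ ?_)
  have hx := rpow_neg_mem_Icc p.2 hs.le
  have hx1 : (((p : ℕ) : ℝ) ^ s)⁻¹ < 1 := by linarith [hx.2, inv_prime_le_half p.2]
  simp only [quotientEulerFactor, one_mul]
  rw [tsum_geometric_of_lt_one hx.1 hx1]
  have : 1 - (((p : ℕ) : ℝ) ^ s)⁻¹ ≠ 0 := by linarith
  rw [mul_right_comm, mul_inv_cancel₀ this, one_mul]

/-- If a multiplicative function with values in `[0, 1]` is equal to `1` at all primes but at most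
one and has a mean value, then this mean value is given by the expected Euler product. -/
theorem meanValue_eq_tprod (h1 : g 1 = 1)
    (hmul : ∀ {m n : ℕ}, m.Coprime n → g (m * n) = g m * g n)
    (h0 : ∀ n, 0 ≤ g n) (hle : ∀ n, g n ≤ 1) {q : ℕ} (hq : 0 < q)
    (hg : ∀ p : ℕ, p.Prime → p ≠ q → g p = 1) {l : ℝ}
    (hl : Tendsto (fun n : ℕ ↦ (∑ k ∈ Finset.Icc 1 n, g k) / (n : ℝ)) atTop (𝓝 l)) :
    l = ∏' p : {p : ℕ // p.Prime}, quotientEulerFactor g p ((p : ℕ) : ℝ)⁻¹ := by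
  have hprod : Tendsto (fun s : ℝ ↦ ∏' p : {p : ℕ // p.Prime},
      quotientEulerFactor g p (((p : ℕ) : ℝ) ^ s)⁻¹) (𝓝[>] 1)
      (𝓝 (∏' p : {p : ℕ // p.Prime}, quotientEulerFactor g p ((p : ℕ) : ℝ)⁻¹)) := by
    have key := tendsto_tprod_one_add_of_dominated_convergence (𝓕 := 𝓝[>] (1 : ℝ))
      (f := fun s (p : {p : ℕ // p.Prime}) ↦
        quotientEulerFactor g p (((p : ℕ) : ℝ) ^ s)⁻¹ - 1)
      (g := fun p : {p : ℕ // p.Prime} ↦ quotientEulerFactor g p ((p : ℕ) : ℝ)⁻¹ - 1)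
      (summable_const_mul_inv_prime_sq ((q : ℝ) ^ 2))
      (fun p ↦ by
        have hp := inv_prime_le_half p.2
        have hc : ContinuousOn (quotientEulerFactor g p) (Set.Icc 0 (1 / 2)) :=
          (by fun_prop : ContinuousOn (fun x : ℝ ↦ 1 - x) _).mul
            (continuousOn_tsum_mul_pow (fun m ↦ h0 _) (fun m ↦ hle _) (by norm_num) (by norm_num))
        exact ((hc _ ⟨by positivity, hp⟩).tendsto.comp
          (tendsto_inv_rpow_nhdsGT_one p.2)).sub_const 1)
      (by
        filter_upwards [self_mem_nhdsWithin] with s hs p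
        have hx := rpow_neg_mem_Icc p.2 (le_of_lt hs)
        exact abs_quotientEulerFactor_sub_one_le h1 h0 hle hq hg p.2 hx.1 hx.2)
    simpa using key
  have hlim := hprod.mul tendsto_sub_mul_tsum_nat_rpow
  rw [mul_one] at hlim
  refine tendsto_nhds_unique (tendsto_sub_mul_tsum_div_rpow h0 hl) (hlim.congr' ?_)
  filter_upwards [self_mem_nhdsWithin] with s hs
  rw [mul_left_comm, tprod_quotientEulerFactor_mul_tsum h1 hmul h0 hle hq hg hs]

end MeanValue

namespace TowerMem

variable {q : ℕ}

lemma two_le {n : ℕ} (h : TowerMem q n) : 2 ≤ n := by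
  cases h <;> assumption

lemma iff_dvd_or_exists {n : ℕ} (hn : n ≠ 0) (hq : q.Prime) :
    TowerMem q n ↔ q ∣ n ∨ ∃ p : ℕ, TowerMem q (n.factorization p) := by
  constructor
  · intro h
    cases h with
    | base _ _ hdvd => exact .inl hdvd
    | step _ p _ _ _ hexp => exact .inr ⟨p, hexp⟩
  · rintro (h | ⟨p, h⟩)
    · exact .base n (hq.two_le.trans (Nat.le_of_dvd (Nat.pos_of_ne_zero hn) h)) h
    · have hne : n.factorization p ≠ 0 := by have := h.two_le; omega
      have hp : p.Prime := by
        by_contra hp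
        exact hne (Nat.factorization_eq_zero_of_not_prime n hp)
      have hdvd := Nat.dvd_of_factorization_pos hne
      exact .step n p (hp.two_le.trans (Nat.le_of_dvd (Nat.pos_of_ne_zero hn) hdvd)) hp hdvd h

lemma not_zero : ¬ TowerMem q 0 := fun h ↦ by simpa using h.two_le

lemma not_one : ¬ TowerMem q 1 := fun h ↦ by simpa using h.two_le

lemma mul_iff (hq : q.Prime) {m n : ℕ} (hm : m ≠ 0) (hn : n ≠ 0) (hmn : m.Coprime n) :
    TowerMem q (m * n) ↔ TowerMem q m ∨ TowerMem q n := by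
  have hfac : ∀ p, TowerMem q ((m * n).factorization p) ↔
      TowerMem q (m.factorization p) ∨ TowerMem q (n.factorization p) := by
    intro p
    rw [Nat.factorization_mul hm hn, Finsupp.add_apply]
    by_cases hpm : p ∈ m.primeFactors
    · have hpn : n.factorization p = 0 := by
        rw [← Finsupp.notMem_support_iff, Nat.support_factorization]
        exact Finset.disjoint_left.1 hmn.disjoint_primeFactors hpm
      simp [hpn, not_zero]
    · have hpm' : m.factorization p = 0 := by
        rwa [← Finsupp.notMem_support_iff, Nat.support_factorization]
      simp [hpm', not_zero]
  rw [iff_dvd_or_exists (mul_ne_zero hm hn) hq, iff_dvd_or_exists hm hq, iff_dvd_or_exists hn hq,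
    hq.dvd_mul]
  simp only [hfac, exists_or]
  tauto

lemma not_prime (hq : q.Prime) {p : ℕ} (hp : p.Prime) (hpq : p ≠ q) : ¬ TowerMem q p := by
  rw [iff_dvd_or_exists hp.ne_zero hq]
  rintro (h | ⟨r, h⟩)
  · exact hpq ((Nat.prime_dvd_prime_iff_eq hq hp).1 h).symm
  · have h2 := h.two_le
    rw [hp.factorization, Finsupp.single_apply] at h2
    split_ifs at h2 <;> omega

end TowerMem

open Classical in
theorem tower_density_compl_eq_prod_indicator (q : ℕ) (hq : q.Prime)
    (I : ℕ → ℝ) (hI : ∀ n, I n = if TowerMem q n then 0 else 1)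
    (d : ℝ) (hd : Tendsto (towerRatio q) atTop (𝓝 d)) :
    1 - d = ∏' p : {p : ℕ // p.Prime},
      ((1 - 1 / ((p : ℕ) : ℝ)) * ∑' m : ℕ, I ((p : ℕ) ^ m) / ((p : ℕ) : ℝ) ^ m) := by
  classical
  have hmean : Tendsto (fun n : ℕ ↦
      (∑ k ∈ Finset.Icc 1 n, if k = 0 then 0 else I k) / (n : ℝ)) atTop (𝓝 (1 - d)) := by
    refine (hd.const_sub 1).congr' ?_
    filter_upwards [eventually_gt_atTop 0] with N hN
    have hN' : (N : ℝ) ≠ 0 := by exact_mod_cast hN.ne'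
    have hsum : (∑ k ∈ Finset.Icc 1 N, if k = 0 then 0 else I k) =
        N - (((Finset.Icc 1 N).filter fun n => TowerMem q n).card : ℝ) := by
      rw [Finset.card_filter, Nat.cast_sum, eq_sub_iff_add_eq, ← Finset.sum_add_distrib]
      calc _ = ∑ k ∈ Finset.Icc 1 N, (1 : ℝ) := Finset.sum_congr rfl fun k hk ↦ by
            have hk0 : k ≠ 0 := by have := (Finset.mem_Icc.1 hk).1; omega
            rw [if_neg hk0, hI]
            split_ifs <;> simp
        _ = N := by simp
    rw [hsum, sub_div, div_self hN', towerRatio]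
  have hval : ∀ n, I n = 0 ∨ I n = 1 := fun n ↦ by rw [hI]; split_ifs <;> simp
  rw [meanValue_eq_tprod (q := q) (by simp [hI, TowerMem.not_one])
    (fun {m n} hmn ↦ ?_) (fun n ↦ ?_) (fun n ↦ ?_) hq.pos
    (fun p hp hpq ↦ by simp [hI, hp.ne_zero, TowerMem.not_prime hq hp hpq]) hmean]
  · refine tprod_congr fun p ↦ ?_
    simp only [quotientEulerFactor, one_mul, pow_eq_zero_iff', p.2.ne_zero, false_and, if_false,
      inv_pow, div_eq_mul_inv]
  · rcases eq_or_ne m 0 with rfl | hm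
    · simp
    rcases eq_or_ne n 0 with rfl | hn
    · simp
    simp only [hm, hn, mul_eq_zero, or_self, if_false, hI, TowerMem.mul_iff hq hm hn hmn]
    by_cases h1 : TowerMem q m <;> by_cases h2 : TowerMem q n <;> simp [h1, h2]
  · split_ifs
    · exact le_rfl
    · rcases hval n with h | h <;> simp [h]
  · split_ifs
    · exact zero_le_one
    · rcases hval n with h | h <;> simp [h]
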